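/- arXiv:1708.05462 — 2 statements merged into one kernel-verified Lean document; each statement's English description precedes it below -/
import Mathlib

section
/- Fix ρ ∈ (0,1) and ξ ∈ (0, ρ]. There exists an integer n0 such that for all n ≥ n0 the following holds: let r = ⌊ρn⌋ and let w be any integer with r ≤ w ≤ n. If (Enc,Dec) is a (k,n)-coding scheme that is non-malleable with respect to the tampering family F_BIT^{[n],r,w} with exact security ε, and k ≥ n(1 − ρ + ξ), then ε ≥ ξ/(16ρ). (This gives the rate upper bound 1 − ρ_r for non-malleable codes when ρ_r ≤ ρ_w.) -/
/-- Binary words of length `n`. -/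
abbrev Word (n : ℕ) := Fin n → Bool

/-- Statistical distance between two distributions on a finite type. -/
noncomputable def SD {Z : Type*} [Fintype Z] (X Y : PMF Z) : ℝ :=
  (1 / 2) * ∑ z, |(X z).toReal - (Y z).toReal|

/-- Restriction of a distribution on words to the coordinates in `S`. -/
noncomputable def restrictPMF {n : ℕ} (S : Finset (Fin n)) (X : PMF (Word n)) :
    PMF ({i : Fin n // i ∈ S} → Bool) :=
  X.map (fun c j => c j.1)

/-- Correctness of a `(k,n)`-coding scheme: decoding a sampled codeword
always returns the message. -/
def Correct {k n : ℕ} (Enc : Word k → PMF (Word n))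
    (Dec : Word n → Option (Word k)) : Prop :=
  ∀ (m : Word k), ∀ c ∈ (Enc m).support, Dec c = some m

/-- The tampering family `F_BIT^{[n],r,w}`: read a set `Sr` of `r` coordinates,
and based on the read values apply bit-tampering functions on a set `Sw`
of `w` coordinates, leaving the others untouched. -/
def FBIT (n r w : ℕ) : Set (Word n → Word n) :=
  { f | ∃ (Sr Sw : Finset (Fin n)), Sr.card = r ∧ Sw.card = w ∧
      ∃ g : ({i : Fin n // i ∈ Sr} → Bool) → ({i : Fin n // i ∈ Sw} → Bool → Bool),
        ∀ (x : Word n) (i : Fin n),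
          f x i = if h : i ∈ Sw then g (fun j => x j.1) ⟨i, h⟩ (x i) else x i }

/-- Outcome alphabet `{0,1}^k ∪ {⊥, same*}`: `Sum.inl m` is a message,
`Sum.inr false` is `⊥`, and `Sum.inr true` is `same*`. -/
abbrev NMOut (k : ℕ) := Word k ⊕ Bool

/-- Patching an outcome with the real message `m`. -/
def patchOut {k : ℕ} (m : Word k) : NMOut k → Option (Word k)
  | Sum.inl m' => some m'
  | Sum.inr true => some m
  | Sum.inr false => none

/-- The distribution of `Dec(f(c))` for `c ← Enc(m)`. -/
noncomputable def TamperDist {k n : ℕ} (Enc : Word k → PMF (Word n))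
    (Dec : Word n → Option (Word k)) (f : Word n → Word n) (m : Word k) :
    PMF (Option (Word k)) :=
  (Enc m).map (fun c => Dec (f c))

/-- `Patch(D, m)`: sample from `D`, replacing `same*` by `m`. -/
noncomputable def PatchDist {k : ℕ} (D : PMF (NMOut k)) (m : Word k) :
    PMF (Option (Word k)) :=
  D.map (patchOut m)

/-- Non-malleability of `(Enc,Dec)` w.r.t. a family `F` with exact security `ε`. -/
def NonMalleable {k n : ℕ} (Enc : Word k → PMF (Word n))
    (Dec : Word n → Option (Word k)) (F : Set (Word n → Word n)) (ε : ℝ) : Prop :=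
  ∀ f ∈ F, ∃ D : PMF (NMOut k), ∀ m : Word k,
    SD (TamperDist Enc Dec f m) (PatchDist D m) ≤ ε

/-- The strong tampering experiment `StrongNM_m^f`. -/
noncomputable def StrongExp {k n : ℕ} (Enc : Word k → PMF (Word n))
    (Dec : Word n → Option (Word k)) (f : Word n → Word n) (m : Word k) :
    PMF (NMOut k) :=
  (Enc m).map (fun c =>
    if f c = c then (Sum.inr true : NMOut k)
    else
      match Dec (f c) with
      | some m' => Sum.inl m'
      | none => Sum.inr false)

/-- Strong non-malleability with exact security `ε`. -/
def StronglyNonMalleable {k n : ℕ} (Enc : Word k → PMF (Word n))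
    (Dec : Word n → Option (Word k)) (F : Set (Word n → Word n)) (ε : ℝ) : Prop :=
  ∀ f ∈ F, ∀ m0 m1 : Word k,
    SD (StrongExp Enc Dec f m0) (StrongExp Enc Dec f m1) ≤ ε

lemma PMF.sum_toReal {Z : Type*} [Fintype Z] (X : PMF Z) : ∑ z, (X z).toReal = 1 := by
  rw [← ENNReal.toReal_sum fun y _ => X.apply_ne_top y, ← tsum_fintype (L := .unconditional _),
    X.tsum_coe, ENNReal.toReal_one]

open Finset in
/-- The statistical distance bounds the difference of the point masses at every point. -/
lemma abs_sub_le_SD {Z : Type*} [Fintype Z] (X Y : PMF Z) (z : Z) :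
    |(X z).toReal - (Y z).toReal| ≤ SD X Y := by
  classical
  have hdiff : ∑ y, ((X y).toReal - (Y y).toReal) = 0 := by
    rw [sum_sub_distrib, PMF.sum_toReal, PMF.sum_toReal, sub_self]
  rw [← add_sum_erase _ _ (mem_univ z)] at hdiff
  have habs := abs_sum_le_sum_abs (fun y => (X y).toReal - (Y y).toReal) (univ.erase z)
  rw [eq_neg_of_add_eq_zero_right hdiff, abs_neg] at habs
  unfold SD
  rw [← add_sum_erase _ _ (mem_univ z)]
  linarith

open Classical in
lemma PMF.toReal_map_apply {Y Z : Type*} [Fintype Y] (X : PMF Y) (f : Y → Z) (z : Z) :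
    ((X.map f) z).toReal = ∑ y, if z = f y then (X y).toReal else 0 := by
  rw [PMF.map_apply, tsum_fintype, ENNReal.toReal_sum]
  · refine Finset.sum_congr rfl fun y _ => ?_
    split_ifs <;> simp
  · intro y _
    split_ifs
    · exact X.apply_ne_top y
    · simp

lemma toReal_PatchDist_some {k : ℕ} (D : PMF (NMOut k)) (m : Word k) :
    (PatchDist D m (some m)).toReal = (D (Sum.inl m)).toReal + (D (Sum.inr true)).toReal := by
  classical
  rw [PatchDist, PMF.toReal_map_apply]
  simp [patchOut]

/-- Restriction of a word to the coordinates in `S`. -/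
def restrictWord {n : ℕ} (S : Finset (Fin n)) (x : Word n) : {i : Fin n // i ∈ S} → Bool :=
  fun j => x j.1

/-- Replace the coordinates of `x` in `S` by `β`. -/
def overwrite {n : ℕ} (S : Finset (Fin n)) (β : {i : Fin n // i ∈ S} → Bool) (x : Word n) :
    Word n :=
  fun i => if h : i ∈ S then β ⟨i, h⟩ else x i

open Classical in
/-- Overwrite the coordinates in `S` by `β` when the values read there lie in `A`. -/
noncomputable def overwriteOn {n : ℕ} (S : Finset (Fin n))
    (A : Set ({i : Fin n // i ∈ S} → Bool)) (β : {i : Fin n // i ∈ S} → Bool) (x : Word n) :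
    Word n :=
  if restrictWord S x ∈ A then overwrite S β x else x

lemma overwrite_injective {n : ℕ} (S : Finset (Fin n)) (x : Word n) :
    Function.Injective fun β => overwrite S β x := by
  intro β γ h
  funext i
  simpa [overwrite] using congrFun h i.1

lemma overwriteOn_mem_FBIT {n r w : ℕ} {S : Finset (Fin n)} (hS : S.card = r) (hrw : r ≤ w)
    (hwn : w ≤ n) (A : Set ({i : Fin n // i ∈ S} → Bool)) (β : {i : Fin n // i ∈ S} → Bool) :
    overwriteOn S A β ∈ FBIT n r w := by
  classical
  obtain ⟨T, hST, hT⟩ := Finset.exists_superset_card_eq (s := S) (n := w)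
    (by omega) (by simpa using hwn)
  refine ⟨S, T, hS, hT, fun a i b => if h : i.1 ∈ S then (if a ∈ A then β ⟨i.1, h⟩ else b) else b,
    fun x i => ?_⟩
  by_cases hiS : i ∈ S
  · have hiT := hST hiS
    by_cases hA : restrictWord S x ∈ A
    · simp only [overwriteOn, if_pos hA, overwrite, dif_pos hiS, dif_pos hiT]
      exact (if_pos hA).symm
    · simp only [overwriteOn, if_neg hA, dif_pos hiS, dif_pos hiT]
      exact (if_neg hA).symm
  · by_cases hA : restrictWord S x ∈ A <;> simp [overwriteOn, hA, overwrite, hiS]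

/-- The restrictions to `S` of the words decoding to `m`. -/
def compatible {k n : ℕ} (Dec : Word n → Option (Word k)) (S : Finset (Fin n)) (m : Word k) :
    Set ({i : Fin n // i ∈ S} → Bool) :=
  {a | ∃ x, restrictWord S x = a ∧ Dec x = some m}

open Classical in
/-- The values read on `S` are compatible with at most `2 ^ (n - |S|)` messages. -/
lemma card_compatible_le {k n r : ℕ} (Dec : Word n → Option (Word k)) {S : Finset (Fin n)}
    (hS : S.card = r) (a : {i : Fin n // i ∈ S} → Bool) :
    (Finset.univ.filter fun m => a ∈ compatible Dec S m).card ≤ 2 ^ (n - r) := by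
  have hmap : ∀ m ∈ (Finset.univ.filter fun m => a ∈ compatible Dec S m),
      some m ∈ (Finset.univ : Finset ({i : Fin n // i ∉ S} → Bool)).image
        (fun γ => Dec (fun i => if h : i ∈ S then a ⟨i, h⟩ else γ ⟨i, h⟩)) := by
    intro m hm
    obtain ⟨x, rfl, hx⟩ := (Finset.mem_filter.mp hm).2
    refine Finset.mem_image.mpr ⟨fun i => x i.1, Finset.mem_univ _, ?_⟩
    rw [← hx]
    congr 1
    funext i
    split_ifs <;> rfl
  calc _ ≤ _ := Finset.card_le_card_of_injOn some hmap (Option.some_injective _).injOn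
    _ ≤ _ := Finset.card_image_le
    _ = 2 ^ (n - r) := by
      simp [Fintype.card_subtype_compl, hS]

open Classical in
/-- Some message `m` has few words decoding to it, and a uniformly random message is unlikely to be
encoded into a word which looks on `S` like an encoding of `m`. -/
lemma exists_rarely_compatible {k n r : ℕ} (Enc : Word k → PMF (Word n))
    (Dec : Word n → Option (Word k)) {S : Finset (Fin n)} (hS : S.card = r) (hrn : r ≤ n) :
    ∃ m₀ : Word k,
      (∑ m, ∑ x, if restrictWord S x ∈ compatible Dec S m₀ then (Enc m x).toReal else 0) / 2 ^ k +
        ((Finset.univ.filter fun x => Dec x = some m₀).card : ℝ) / 2 ^ r ≤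
      2 * 2 ^ (n - r) / 2 ^ k := by
  have hcompat : ∑ m₀ : Word k, ∑ m, ∑ x,
      (if restrictWord S x ∈ compatible Dec S m₀ then (Enc m x).toReal else 0) ≤
      2 ^ k * 2 ^ (n - r) := by
    rw [Finset.sum_comm]
    have hm (m : Word k) : ∑ m₀ : Word k, ∑ x,
        (if restrictWord S x ∈ compatible Dec S m₀ then (Enc m x).toReal else 0) ≤
        2 ^ (n - r) := by
      rw [Finset.sum_comm]
      calc _ ≤ ∑ x, 2 ^ (n - r) * (Enc m x).toReal := by
            refine Finset.sum_le_sum fun x _ => ?_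
            rw [← Finset.sum_filter, Finset.sum_const, nsmul_eq_mul]
            gcongr
            exact_mod_cast card_compatible_le Dec hS (restrictWord S x)
        _ = 2 ^ (n - r) := by rw [← Finset.mul_sum, PMF.sum_toReal, mul_one]
    exact (Finset.sum_le_sum fun m _ => hm m).trans (by simp)
  have hdecode : ∑ m₀ : Word k, ((Finset.univ.filter fun x => Dec x = some m₀).card : ℝ) ≤
      2 ^ n := by
    have hunion : (Finset.univ.biUnion fun m₀ : Word k =>
        Finset.univ.filter fun x => Dec x = some m₀).card ≤ 2 ^ n := by
      simpa using Finset.card_le_univ (Finset.univ.biUnion fun m₀ : Word k =>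
        Finset.univ.filter fun x => Dec x = some m₀)
    rw [Finset.card_biUnion] at hunion
    · exact_mod_cast hunion
    · intro m _ m' _ hne
      refine Finset.disjoint_left.mpr fun x hx hx' => hne ?_
      simp only [Finset.mem_filter, Finset.mem_univ, true_and] at hx hx'
      exact Option.some_injective _ (hx.symm.trans hx')
  have hpow : (2 : ℝ) ^ n = 2 ^ (n - r) * 2 ^ r := by rw [← pow_add, Nat.sub_add_cancel hrn]
  obtain ⟨m₀, -, h⟩ := Finset.exists_le_of_sum_le (s := (Finset.univ : Finset (Word k)))
    (f := fun m₀ =>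
      (∑ m, ∑ x, if restrictWord S x ∈ compatible Dec S m₀ then (Enc m x).toReal else 0) / 2 ^ k +
        ((Finset.univ.filter fun x => Dec x = some m₀).card : ℝ) / 2 ^ r)
    (g := fun _ => 2 * 2 ^ (n - r) / 2 ^ k) Finset.univ_nonempty (by
      rw [Finset.sum_add_distrib, ← Finset.sum_div, ← Finset.sum_div]
      have h₁ := (div_le_iff₀' (by positivity)).mpr hcompat
      have h₂ : _ / (2 : ℝ) ^ r ≤ 2 ^ (n - r) :=
        (div_le_iff₀ (by positivity)).mpr (hdecode.trans hpow.le)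
      have h₃ : ∑ _m : Word k, (2 : ℝ) * 2 ^ (n - r) / 2 ^ k = 2 * 2 ^ (n - r) := by
        simp
        field_simp
      linarith)
  exact ⟨m₀, h⟩

open Classical in
/-- Some value of the overwritten coordinates makes decoding to `m` unlikely. -/
lemma exists_overwrite_rarely_decodes {k n r : ℕ} (X : PMF (Word n))
    (Dec : Word n → Option (Word k)) {S : Finset (Fin n)} (hS : S.card = r) (m : Word k) :
    ∃ β, (∑ x, if Dec (overwrite S β x) = some m then (X x).toReal else 0) ≤
      ((Finset.univ.filter fun x => Dec x = some m).card : ℝ) / 2 ^ r := by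
  set c : ℝ := ((Finset.univ.filter fun x => Dec x = some m).card : ℝ) with hc
  have hsum : ∑ β, ∑ x, (if Dec (overwrite S β x) = some m then (X x).toReal else 0) ≤ c := by
    rw [Finset.sum_comm]
    calc _ ≤ ∑ x, c * (X x).toReal := by
          refine Finset.sum_le_sum fun x _ => ?_
          rw [← Finset.sum_filter, Finset.sum_const, nsmul_eq_mul]
          refine mul_le_mul_of_nonneg_right ?_ ENNReal.toReal_nonneg
          rw [hc]
          exact_mod_cast Finset.card_le_card_of_injOn (fun β => overwrite S β x)
            (fun β hβ => by simpa using hβ) (overwrite_injective S x).injOn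
      _ = c := by rw [← Finset.mul_sum, PMF.sum_toReal, mul_one]
  obtain ⟨β, -, h⟩ := Finset.exists_le_of_sum_le
    (s := (Finset.univ : Finset ({i : Fin n // i ∈ S} → Bool)))
    (f := fun β => ∑ x, if Dec (overwrite S β x) = some m then (X x).toReal else 0)
    (g := fun _ => c / 2 ^ r) Finset.univ_nonempty (by
      refine hsum.trans (le_of_eq ?_)
      simp [hS]
      field_simp)
  exact ⟨β, h⟩

/-- A tamperer that reads and overwrites `r` coordinates defeats every code whose messages are
longer than the remaining `n - r` coordinates. -/
lemma one_sub_two_mul_le_of_nonMalleable {k n r w : ℕ} (hrw : r ≤ w) (hwn : w ≤ n)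
    {Enc : Word k → PMF (Word n)} {Dec : Word n → Option (Word k)} {ε : ℝ}
    (hcorrect : Correct Enc Dec) (hNM : NonMalleable Enc Dec (FBIT n r w) ε) :
    1 - 2 * ε ≤ 2 * 2 ^ (n - r) / 2 ^ k + 1 / 2 ^ k := by
  classical
  obtain ⟨S, -, hS⟩ := Finset.exists_subset_card_eq (s := (Finset.univ : Finset (Fin n)))
    (n := r) (by simpa using hrw.trans hwn)
  obtain ⟨m₀, hm₀⟩ := exists_rarely_compatible Enc Dec hS (hrw.trans hwn)
  obtain ⟨β, hβ⟩ := exists_overwrite_rarely_decodes (Enc m₀) Dec hS m₀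
  obtain ⟨D, hD⟩ := hNM _ (overwriteOn_mem_FBIT hS hrw hwn (compatible Dec S m₀) β)
  have hpoint (m : Word k) := abs_le.mp ((abs_sub_le_SD _ _ (some m)).trans (hD m))
  simp only [toReal_PatchDist_some] at hpoint
  have hdecode (m : Word k) (x : Word n) (hx : (Enc m x).toReal ≠ 0) : Dec x = some m :=
    hcorrect m x ((PMF.mem_support_iff _ _).mpr fun h => hx (by simp [h]))
  have hsame : (D (Sum.inr true)).toReal ≤
      ((Finset.univ.filter fun x => Dec x = some m₀).card : ℝ) / 2 ^ r + ε := by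
    have hT : (TamperDist Enc Dec (overwriteOn S (compatible Dec S m₀) β) m₀ (some m₀)).toReal =
        ∑ x, if Dec (overwrite S β x) = some m₀ then (Enc m₀ x).toReal else 0 := by
      rw [TamperDist, PMF.toReal_map_apply]
      refine Finset.sum_congr rfl fun x _ => ?_
      by_cases hx : (Enc m₀ x).toReal = 0
      · simp [hx]
      · have hA : restrictWord S x ∈ compatible Dec S m₀ := ⟨x, rfl, hdecode _ _ hx⟩
        simp only [overwriteOn, if_pos hA, eq_comm]
    have := (hpoint m₀).1
    rw [hT] at this
    have : 0 ≤ (D (Sum.inl m₀)).toReal := ENNReal.toReal_nonneg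
    linarith
  have huntouched (m : Word k) :
      1 - (∑ x, if restrictWord S x ∈ compatible Dec S m₀ then (Enc m x).toReal else 0) - ε ≤
        (D (Sum.inl m)).toReal + (D (Sum.inr true)).toReal := by
    have hT : 1 - (∑ x, if restrictWord S x ∈ compatible Dec S m₀ then (Enc m x).toReal else 0) ≤
        (TamperDist Enc Dec (overwriteOn S (compatible Dec S m₀) β) m (some m)).toReal := by
      rw [TamperDist, PMF.toReal_map_apply, ← PMF.sum_toReal (Enc m), ← Finset.sum_sub_distrib]
      refine Finset.sum_le_sum fun x _ => ?_
      by_cases hx : (Enc m x).toReal = 0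
      · simp [hx]
      · by_cases hA : restrictWord S x ∈ compatible Dec S m₀
        · simp only [if_pos hA, sub_self]
          split_ifs <;> simp
        · simp [overwriteOn, hA, hdecode _ _ hx]
    linarith [(hpoint m).2]
  have hinl : ∑ m, (D (Sum.inl m)).toReal ≤ 1 := by
    rw [← PMF.sum_toReal D, Fintype.sum_sum_type]
    exact le_add_of_nonneg_right (Finset.sum_nonneg fun _ _ => ENNReal.toReal_nonneg)
  have havg := Finset.sum_le_sum fun m (_ : m ∈ (Finset.univ : Finset (Word k))) => huntouched m
  simp only [Finset.sum_sub_distrib, Finset.sum_add_distrib, Finset.sum_const, Finset.card_univ,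
    Fintype.card_fun, Fintype.card_bool, Fintype.card_fin, nsmul_eq_mul, Nat.cast_pow,
    Nat.cast_ofNat, mul_one] at havg
  set q := ∑ m, ∑ x, if restrictWord S x ∈ compatible Dec S m₀ then (Enc m x).toReal else 0
  have hK : (0 : ℝ) < 2 ^ k := by positivity
  have hlow : 1 - ε - (D (Sum.inr true)).toReal ≤ q / 2 ^ k + 1 / 2 ^ k := by
    rw [← add_div, le_div_iff₀ hK]
    linarith
  linarith

/-- Rate upper bound for (default) non-malleable codes with respect to
`F_BIT^{[n],⌊ρn⌋,w}` for `⌊ρn⌋ ≤ w ≤ n`: rate `1 - ρ + ξ` forces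
exact security `ε ≥ ξ/(16ρ)`. -/
theorem NM_rate_upper_bound
    (ρ ξ : ℝ) (hρ0 : 0 < ρ) (hρ1 : ρ < 1) (hξ0 : 0 < ξ) (hξρ : ξ ≤ ρ) :
    ∃ n0 : ℕ, ∀ n : ℕ, n0 ≤ n →
      ∀ w : ℕ, ⌊ρ * (n : ℝ)⌋₊ ≤ w → w ≤ n →
      ∀ (k : ℕ) (Enc : Word k → PMF (Word n)) (Dec : Word n → Option (Word k)) (ε : ℝ),
        Correct Enc Dec →
        NonMalleable Enc Dec (FBIT n ⌊ρ * (n : ℝ)⌋₊ w) ε →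
        (n : ℝ) * (1 - ρ + ξ) ≤ (k : ℝ) →
        ξ / (16 * ρ) ≤ ε := by
  refine ⟨⌈4 / ξ⌉₊, fun n hn w hrw hwn k Enc Dec ε hcorrect hNM hk => ?_⟩
  have hn' : 4 ≤ ξ * n := by
    rw [← div_le_iff₀' hξ0]
    exact Nat.ceil_le.mp hn
  have hr := Nat.lt_floor_add_one (ρ * (n : ℝ))
  have hbound := one_sub_two_mul_le_of_nonMalleable hrw hwn hcorrect hNM
  set r := ⌊ρ * (n : ℝ)⌋₊
  have hgap : n - r + 3 ≤ k := by
    have : (n : ℝ) + 3 < k + r + 1 := by linarith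
    have : n + 3 < k + r + 1 := by exact_mod_cast this
    omega
  have hrate : (2 : ℝ) ^ (n - r) / 2 ^ k ≤ 1 / 8 := by
    rw [div_le_div_iff₀ (by positivity) (by norm_num), one_mul]
    calc (2 : ℝ) ^ (n - r) * 8 = 2 ^ (n - r + 3) := by rw [pow_add]; norm_num
      _ ≤ 2 ^ k := pow_le_pow_right₀ (by norm_num) hgap
  have hone : (1 : ℝ) / 2 ^ k ≤ 2 ^ (n - r) / 2 ^ k := by
    gcongr
    exact one_le_pow₀ (by norm_num)
  have htarget : ξ / (16 * ρ) ≤ 1 / 16 := by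
    rw [div_le_div_iff₀ (by positivity) (by norm_num)]
    linarith
  rw [mul_div_assoc] at hbound
  linarith
end

section
/- Fix constants ρ_r ∈ (0,1) and ξ ∈ (0, 1 − ρ_r). Then there exist a constant c > 0 and an integer n0 such that for every n ≥ n0 there exists a (k,n)-coding scheme (Enc,Dec) with k ≥ n(1 − ρ_r − ξ) that is a (ρ_r,1)-active adversary wiretap II code with both parameters at most 2^{−cn}: (secrecy) for every S ⊆ [n] with |S| ≤ ⌊nρ_r⌋ and all messages m0, m1, SD(Enc(m0)_S ; Enc(m1)_S) ≤ 2^{−cn}; and (non-malleability) (Enc,Dec) is non-malleable with respect to F_BIT^{[n],⌊nρ_r⌋,n} with exact security 2^{−cn}. (Hence the capacity of (ρ_r,1)-active adversary wiretap II codes is at least 1 − ρ_r.) -/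
/-- Expectation over a random labelling of `V` whose labels are independent with law `w`. -/
noncomputable def labelExp {V Λ : Type*} [Fintype V] [Fintype Λ] [DecidableEq V]
    (w : Λ → ℝ) (φ : (V → Λ) → ℝ) : ℝ :=
  ∑ L : V → Λ, (∏ x, w (L x)) * φ L

section RandomLabelling

variable {V Λ : Type*} [Fintype V] [Fintype Λ] [DecidableEq V] {w : Λ → ℝ}

theorem labelExp_prod (φ : V → Λ → ℝ) :
    labelExp w (fun L => ∏ x, φ x (L x)) = ∏ x, ∑ l, w l * φ x l := by
  simp [labelExp, ← Finset.prod_mul_distrib, Finset.prod_univ_sum, Fintype.piFinset_univ]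

theorem labelExp_mono (hw : ∀ l, 0 ≤ w l) {φ ψ : (V → Λ) → ℝ} (h : ∀ L, φ L ≤ ψ L) :
    labelExp w φ ≤ labelExp w ψ :=
  Finset.sum_le_sum fun L _ =>
    mul_le_mul_of_nonneg_left (h L) (Finset.prod_nonneg fun _ _ => hw _)

theorem labelExp_mul_const (φ : (V → Λ) → ℝ) (c : ℝ) :
    labelExp w (fun L => φ L * c) = labelExp w φ * c := by
  simp [labelExp, Finset.sum_mul, mul_assoc]

theorem labelExp_add (φ ψ : (V → Λ) → ℝ) :
    labelExp w (fun L => φ L + ψ L) = labelExp w φ + labelExp w ψ := by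
  simp [labelExp, mul_add, Finset.sum_add_distrib]

theorem labelExp_one (hw1 : ∑ l, w l = 1) :
    labelExp w (fun _ : V → Λ => 1) = 1 := by
  have := labelExp_prod (V := V) (w := w) (fun _ _ => 1)
  simpa [hw1] using this

/-- The union bound, with each bad event dominated by a nonnegative penalty. -/
theorem exists_labelling_forall_lt_one {J : Type*} [Fintype J] (hw : ∀ l, 0 ≤ w l)
    (hw1 : ∑ l, w l = 1) (Φ : J → (V → Λ) → ℝ) (hΦ : ∀ j L, 0 ≤ Φ j L) {η : ℝ}
    (hη : ∀ j, labelExp w (Φ j) ≤ η) (hJ : Fintype.card J * η < 1) :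
    ∃ L : V → Λ, ∀ j, Φ j L < 1 := by
  by_contra! hcon
  have h1 : labelExp w (fun _ : V → Λ => 1) ≤ labelExp w (fun L => ∑ j, Φ j L) := by
    refine labelExp_mono hw fun L => ?_
    obtain ⟨j, hj⟩ := hcon L
    exact hj.trans (Finset.single_le_sum (f := fun j => Φ j L) (fun j _ => hΦ j L)
      (Finset.mem_univ j))
  have h2 : labelExp w (fun L => ∑ j, Φ j L) = ∑ j, labelExp w (Φ j) := by
    simp only [labelExp, Finset.mul_sum]
    exact Finset.sum_comm
  have h3 : ∑ j, labelExp w (Φ j) ≤ Fintype.card J * η := by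
    simpa using Finset.sum_le_sum fun j (_ : j ∈ Finset.univ) => hη j
  rw [labelExp_one hw1, h2] at h1
  linarith

theorem sum_mul_ite_eq [DecidableEq Λ] (hw1 : ∑ l, w l = 1) (G : Finset Λ) (e : ℝ) :
    ∑ l, w l * (if l ∈ G then e else 1) = 1 + (∑ l ∈ G, w l) * (e - 1) := by
  have : ∀ l, w l * (if l ∈ G then e else 1) = w l + (if l ∈ G then w l else 0) * (e - 1) := by
    intro l; split_ifs <;> ring
  simp [this, Finset.sum_add_distrib, hw1, ← Finset.sum_mul]

theorem exp_mul_card_filter (θ : ℝ) (B : Finset V) (P : V → Prop) [DecidablePred P] :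
    Real.exp (θ * (B.filter P).card) = ∏ x, if x ∈ B ∧ P x then Real.exp θ else 1 := by
  rw [← Finset.prod_filter, Finset.prod_const, mul_comm, Real.exp_nat_mul]
  congr 2
  ext; simp

/-- Moment generating function of the number of points of `B` labelled `l₀`. -/
theorem labelExp_exp_card_le [DecidableEq Λ] (hw : ∀ l, 0 ≤ w l) (hw1 : ∑ l, w l = 1) (B : Finset V)
    (l₀ : Λ) (θ : ℝ) :
    labelExp w (fun L => Real.exp (θ * (B.filter fun x => L x = l₀).card)) ≤
      Real.exp (w l₀ * B.card * (Real.exp θ - 1)) := by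
  simp only [exp_mul_card_filter]
  rw [labelExp_prod fun x l => if x ∈ B ∧ l = l₀ then Real.exp θ else 1]
  have h : ∀ x, ∑ l, w l * (if x ∈ B ∧ l = l₀ then Real.exp θ else 1) =
      if x ∈ B then 1 + w l₀ * (Real.exp θ - 1) else 1 := by
    intro x
    by_cases hx : x ∈ B
    · simpa [hx] using sum_mul_ite_eq hw1 {l₀} (Real.exp θ)
    · simp [hx, hw1]
  have hl : w l₀ ≤ 1 := hw1 ▸ Finset.single_le_sum (fun l _ => hw l) (Finset.mem_univ l₀)
  simp only [h, Finset.prod_ite_mem, Finset.univ_inter, Finset.prod_const]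
  rw [mul_right_comm, mul_comm _ (B.card : ℝ), Real.exp_nat_mul]
  refine pow_le_pow_left₀ ?_ (by linarith [Real.add_one_le_exp (w l₀ * (Real.exp θ - 1))]) _
  nlinarith [hw l₀, Real.exp_pos θ]

/-- Chernoff bound for both tails, in penalty form. -/
theorem labelExp_chernoff [DecidableEq Λ] (hw : ∀ l, 0 ≤ w l) (hw1 : ∑ l, w l = 1) (B : Finset V)
    (l₀ : Λ) {θ δ : ℝ} (hθ : |θ| = δ / 2) (hδ1 : δ ≤ 1) :
    labelExp w (fun L => Real.exp (θ * ((B.filter fun x => L x = l₀).card - w l₀ * B.card)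
        - δ ^ 2 / 2 * (w l₀ * B.card))) ≤
      Real.exp (-(w l₀ * B.card * δ ^ 2 / 4)) := by
  set μ := w l₀ * B.card with hμ
  have hμ0 : 0 ≤ μ := mul_nonneg (hw _) (Nat.cast_nonneg _)
  have : ∀ L : V → Λ, Real.exp (θ * ((B.filter fun x => L x = l₀).card - μ) - δ ^ 2 / 2 * μ)
      = Real.exp (θ * (B.filter fun x => L x = l₀).card) *
        Real.exp (-(θ * μ) - δ ^ 2 / 2 * μ) := by
    intro L; rw [← Real.exp_add]; ring_nf
  simp only [this, labelExp_mul_const]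
  refine (mul_le_mul_of_nonneg_right (labelExp_exp_card_le hw hw1 B l₀ θ)
    (Real.exp_pos _).le).trans ?_
  rw [← Real.exp_add, Real.exp_le_exp, ← hμ]
  have h1 := (abs_le.1 (Real.abs_exp_sub_one_sub_id_le (x := θ) (by rw [hθ]; linarith))).2
  have h2 : θ ^ 2 = δ ^ 2 / 4 := by rw [← sq_abs, hθ]; ring
  nlinarith [mul_le_mul_of_nonneg_left h1 hμ0]

/-- The labels on `p` may be resampled independently of those off `p`. -/
theorem labelExp_labelExp_ite (hw1 : ∑ l, w l = 1) (p : V → Prop) [DecidablePred p]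
    (φ : (V → Λ) → ℝ) :
    labelExp w (fun L₂ => labelExp w fun L₁ => φ fun x => if p x then L₁ x else L₂ x) =
      labelExp w φ := by
  let mix : (V → Λ) → (V → Λ) → V → Λ := fun A B x => if p x then A x else B x
  have hmix : ∀ A B, mix (mix A B) (mix B A) = A := by
    intro A B; ext x; by_cases hx : p x <;> simp [mix, hx]
  let σ : ((V → Λ) × (V → Λ)) ≃ ((V → Λ) × (V → Λ)) :=
    { toFun := fun z => (mix z.1 z.2, mix z.2 z.1)
      invFun := fun z => (mix z.1 z.2, mix z.2 z.1)
      left_inv := fun z => by simp [hmix]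
      right_inv := fun z => by simp [hmix] }
  have h1 : labelExp w φ =
      ∑ z : (V → Λ) × (V → Λ), (∏ x, w (z.1 x)) * ((∏ x, w (z.2 x)) * φ z.2) := by
    rw [Fintype.sum_prod_type]
    have h := labelExp_one (V := V) hw1
    simp only [labelExp, mul_one] at h
    simp only [← Finset.mul_sum, ← Finset.sum_mul, h, one_mul, labelExp]
  rw [h1, ← Equiv.sum_comp σ, Fintype.sum_prod_type]
  simp only [labelExp, Finset.mul_sum]
  refine Finset.sum_congr rfl fun L₂ _ => Finset.sum_congr rfl fun L₁ _ => ?_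
  simp only [← mul_assoc, ← Finset.prod_mul_distrib]
  congr 1
  refine Finset.prod_congr rfl fun x _ => ?_
  by_cases hx : p x <;> simp [σ, mix, hx, mul_comm]

/-- Moment generating function of the number of sources `x ∈ X` labelled `l₀` whose target `h x`
has a label in `G`, when `p` separates the sources from the targets. -/
theorem labelExp_exp_card_pairs_le [DecidableEq Λ] (hw : ∀ l, 0 ≤ w l) (hw1 : ∑ l, w l = 1)
    (p : V → Prop) [DecidablePred p] (X : Finset V) (h : V → V) (hX : ∀ x ∈ X, p x ∧ ¬ p (h x))
    (l₀ : Λ) (G : Finset Λ) {θ : ℝ} (hθ0 : 0 ≤ θ) (hθ1 : θ ≤ 1)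
    (hfib : ∀ y, 2 * w l₀ * θ * (X.filter fun x => h x = y).card ≤ 1) :
    labelExp w (fun L => Real.exp (θ * (X.filter fun x => L x = l₀ ∧ L (h x) ∈ G).card)) ≤
      Real.exp (4 * (∑ l ∈ G, w l) * w l₀ * θ * X.card) := by
  set q := ∑ l ∈ G, w l
  have hq0 : 0 ≤ q := Finset.sum_nonneg fun l _ => hw l
  set c := 2 * w l₀ * θ with hc
  have hc0 : 0 ≤ c := by have := hw l₀; positivity
  have hexp : ∀ u : ℝ, 0 ≤ u → u ≤ 1 → Real.exp u - 1 ≤ 2 * u := by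
    intro u hu0 hu1
    have := (abs_le.1 (Real.abs_exp_sub_one_sub_id_le (x := u)
      (by rwa [abs_of_nonneg hu0]))).2
    nlinarith
  -- the labels of the sources, given those of the targets
  have inner : ∀ L₂ : V → Λ,
      labelExp w (fun L₁ : V → Λ =>
        Real.exp (θ * (X.filter fun x => L₁ x = l₀ ∧ L₂ (h x) ∈ G).card)) ≤
      Real.exp (c * (X.filter fun x => L₂ (h x) ∈ G).card) := by
    intro L₂
    have := labelExp_exp_card_le hw hw1 (X.filter fun x => L₂ (h x) ∈ G) l₀ θ
    simp only [Finset.filter_filter] at this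
    simp only [and_comm] at this ⊢
    refine this.trans (Real.exp_le_exp.2 ?_)
    have := mul_le_mul_of_nonneg_left (hexp θ hθ0 hθ1)
      (mul_nonneg (hw l₀) (Nat.cast_nonneg (X.filter fun x => L₂ (h x) ∈ G).card))
    rw [hc]; linarith
  have outer : labelExp w (fun L₂ : V → Λ =>
      Real.exp (c * (X.filter fun x => L₂ (h x) ∈ G).card)) ≤
      Real.exp (4 * q * w l₀ * θ * X.card) := by
    have e1 : ∀ L₂ : V → Λ, Real.exp (c * (X.filter fun x => L₂ (h x) ∈ G).card) =
        ∏ y, if L₂ y ∈ G then Real.exp (c * (X.filter fun x => h x = y).card) else 1 := by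
      intro L₂
      rw [← Finset.prod_filter, ← Real.exp_sum, ← Finset.mul_sum]
      congr 2
      rw [Finset.card_eq_sum_card_fiberwise (f := h)
        (t := Finset.univ.filter fun y => L₂ y ∈ G) (by intro x; simp)]
      push_cast
      refine Finset.sum_congr rfl fun y hy => ?_
      congr 2
      ext x
      simp only [Finset.mem_filter, Finset.mem_univ, true_and] at hy ⊢
      constructor
      · rintro ⟨⟨a, b⟩, c⟩; exact ⟨a, c⟩
      · rintro ⟨a, rfl⟩; exact ⟨⟨a, hy⟩, rfl⟩
    simp only [e1]
    rw [labelExp_prod fun y l => if l ∈ G then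
      Real.exp (c * (X.filter fun x => h x = y).card) else 1]
    simp only [sum_mul_ite_eq hw1]
    calc _ ≤ ∏ y, Real.exp (q * (2 * (c * (X.filter fun x => h x = y).card))) := by
          refine Finset.prod_le_prod (fun y _ => ?_) fun y _ => ?_
          · have : 0 ≤ c * ((X.filter fun x => h x = y).card : ℝ) := by positivity
            have := Real.one_le_exp this
            nlinarith
          · have := mul_le_mul_of_nonneg_left (hexp _ (by positivity) (hfib y)) hq0
            linarith [Real.add_one_le_exp (q * (2 * (c * (X.filter fun x => h x = y).card)))]
      _ = _ := by
          rw [← Real.exp_sum, ← Finset.mul_sum, ← Finset.mul_sum, ← Finset.mul_sum,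
            Finset.card_eq_sum_card_fiberwise (f := h) (s := X) (t := Finset.univ)
              (by intro x; simp)]
          push_cast
          rw [hc]; ring_nf
  refine le_trans (le_of_eq ?_) ((labelExp_mono hw inner).trans outer)
  rw [← labelExp_labelExp_ite hw1 p]
  congr 1; ext L₂; congr 1; ext L₁
  congr 4
  refine Finset.filter_congr fun x hx => ?_
  simp [hX x hx]

end RandomLabelling

/-- The subcube of words agreeing with `a` on `S`. -/
def cube {n : ℕ} (S : Finset (Fin n)) (a : Word n) : Finset (Word n) :=
  Finset.univ.filter fun x => ∀ i ∈ S, x i = a i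

/-- The map applying `h i` to the `i`-th bit. -/
def bitwise {n : ℕ} (h : Fin n → Bool → Bool) (x : Word n) : Word n := fun i => h i (x i)

/-- The coordinates on which a bitwise map is not constant. -/
def freeCoords {n : ℕ} (h : Fin n → Bool → Bool) : Finset (Fin n) :=
  Finset.univ.filter fun i => h i true ≠ h i false

section Cubes

variable {n : ℕ}

theorem mem_cube {S : Finset (Fin n)} {a x : Word n} : x ∈ cube S a ↔ ∀ i ∈ S, x i = a i := by
  simp [cube]

theorem card_cube (S : Finset (Fin n)) (a : Word n) : (cube S a).card = 2 ^ (n - S.card) := by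
  have : cube S a = Fintype.piFinset fun i => if i ∈ S then {a i} else Finset.univ := by
    ext x
    simp only [mem_cube, Fintype.mem_piFinset]
    refine forall_congr' fun i => ?_
    by_cases hi : i ∈ S <;> simp [hi]
  rw [this, Fintype.card_piFinset]
  have h2 : ∀ i, (if i ∈ S then {a i} else Finset.univ : Finset Bool).card =
      if i ∈ Sᶜ then 2 else 1 := by
    intro i; by_cases hi : i ∈ S <;> simp [hi]
  simp only [h2, Finset.prod_ite_mem, Finset.univ_inter, Finset.prod_const, Finset.card_compl,
    Fintype.card_fin]

theorem card_cube_div (S : Finset (Fin n)) (a : Word n) :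
    ((cube S a).card : ℝ) / 2 ^ n = (2 ^ S.card)⁻¹ := by
  have : S.card ≤ n := by simpa using Finset.card_le_univ S
  rw [card_cube, div_eq_iff (by positivity), ← div_eq_inv_mul, eq_div_iff (by positivity)]
  push_cast
  rw [← pow_add, Nat.sub_add_cancel this]

theorem cube_subset_cube {S T : Finset (Fin n)} (h : S ⊆ T) (a : Word n) :
    cube T a ⊆ cube S a := by
  intro x hx
  rw [mem_cube] at *
  exact fun i hi => hx i (h hi)

/-- A fibre of a bitwise map on a cube is empty or a cube. -/
theorem fiber_eq_cube {S : Finset (Fin n)} {a x₀ : Word n} {h : Fin n → Bool → Bool}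
    (hx₀ : x₀ ∈ cube S a) :
    ((cube S a).filter fun x => bitwise h x = bitwise h x₀) = cube (S ∪ freeCoords h) x₀ := by
  ext x
  simp only [Finset.mem_filter, mem_cube, Finset.mem_union, freeCoords, Finset.mem_univ,
    true_and, bitwise, funext_iff] at *
  constructor
  · rintro ⟨h1, h2⟩ i (hi | hi)
    · rw [h1 i hi, hx₀ i hi]
    · have := h2 i
      cases hx : x i <;> cases hy : x₀ i <;> simp_all
  · intro h1
    refine ⟨fun i hi => by rw [h1 i (Or.inl hi), hx₀ i hi], fun i => ?_⟩
    by_cases hi : h i true = h i false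
    · cases x i <;> cases x₀ i <;> simp [hi]
    · rw [h1 i (Or.inr hi)]

/-- The fixed points of a bitwise map in a cube form a cube if there are any. -/
theorem fixed_eq_cube {S : Finset (Fin n)} {a x₀ : Word n} {h : Fin n → Bool → Bool}
    (hx₀ : x₀ ∈ cube S a) (hfix : bitwise h x₀ = x₀) :
    ((cube S a).filter fun x => bitwise h x = x) =
      cube (S ∪ Finset.univ.filter fun i => h i ≠ id) x₀ := by
  ext x
  simp only [Finset.mem_filter, mem_cube, Finset.mem_union, Finset.mem_univ,
    true_and, bitwise, funext_iff] at *
  constructor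
  · rintro ⟨h1, h2⟩ i (hi | hi)
    · rw [h1 i hi, hx₀ i hi]
    · by_contra hne
      refine hi (funext fun b => ?_)
      have := h2 i
      have := hfix i
      cases hx : x i <;> cases hy : x₀ i <;> cases b <;> simp_all
  · intro h1
    refine ⟨fun i hi => by rw [h1 i (Or.inl hi), hx₀ i hi], fun i => ?_⟩
    by_cases hi : h i = id
    · simp [hi]
    · rw [h1 i (Or.inr hi), hfix i]

theorem card_fiber_le {S : Finset (Fin n)} {a : Word n} {h : Fin n → Bool → Bool} (y : Word n) :
    ((cube S a).filter fun x => bitwise h x = y).card ≤ 2 ^ (n - (S ∪ freeCoords h).card) := by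
  rcases ((cube S a).filter fun x => bitwise h x = y).eq_empty_or_nonempty with h0 | ⟨x₀, hx⟩
  · simp [h0]
  · obtain ⟨hx₀, rfl⟩ := Finset.mem_filter.1 hx
    rw [fiber_eq_cube hx₀, card_cube]

/-- A labelling of the words of length `n` whose label classes are equidistributed on cubes of
small codimension, and which rejects most images of bitwise maps of large rank. -/
structure IsPseudorandom {k : ℕ} (r g : ℕ) (L : Word n → Option (Word k)) : Prop where
  /-- Each message is equidistributed on large cubes. -/
  cube_count : ∀ S a m, S.card ≤ r + 2 * g →
    |(((cube S a).filter fun x => L x = some m).card : ℝ) -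
      (2 ^ (k + g))⁻¹ * (cube S a).card| ≤ (2 ^ g)⁻¹ * ((2 ^ (k + g))⁻¹ * (cube S a).card)
  /-- Few codewords are mapped to other codewords. -/
  pair_count : ∀ S a h i b m, S.card = r → r + 2 * g < (S ∪ freeCoords h).card →
    (((cube S a).filter fun x => (x i = b ∧ h i (x i) ≠ b) ∧
      (L x = some m ∧ L (bitwise h x) ≠ none)).card : ℝ) ≤
      8 * (2 ^ g)⁻¹ * (2 ^ (k + g))⁻¹ * (cube S a).card

end Cubes

theorem labelExp_ite_le {V Λ : Type*} [Fintype V] [Fintype Λ] [DecidableEq V] {w : Λ → ℝ}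
    (c : Prop) [Decidable c] (φ : (V → Λ) → ℝ) {η : ℝ} (hη : 0 ≤ η) (h : c → labelExp w φ ≤ η) :
    labelExp w (fun L => if c then φ L else 0) ≤ η := by
  by_cases hc : c
  · simpa [hc] using h hc
  · simpa [hc, labelExp] using hη

/-- The law of a label: each message has probability `2 ^ (-(k + g))`. -/
noncomputable def labelWeight (k g : ℕ) : Option (Word k) → ℝ
  | some _ => (2 ^ (k + g))⁻¹
  | none => 1 - (2 ^ g)⁻¹

theorem labelWeight_nonneg (k g : ℕ) (l : Option (Word k)) : 0 ≤ labelWeight k g l := by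
  cases l with
  | none =>
    have : ((2 : ℝ) ^ g)⁻¹ ≤ 1 := inv_le_one_of_one_le₀ (one_le_pow₀ (by norm_num))
    simpa [labelWeight] using this
  | some m => simp [labelWeight]

theorem sum_labelWeight_some (k g : ℕ) :
    ∑ m : Word k, labelWeight k g (some m) = (2 ^ g)⁻¹ := by
  simp [labelWeight, pow_add]
  field_simp

theorem sum_labelWeight (k g : ℕ) : ∑ l, labelWeight k g l = 1 := by
  rw [Fintype.sum_option, sum_labelWeight_some]
  simp [labelWeight]

theorem exp_union_bound {n k g : ℕ} (hn : 1 ≤ n) (hk : k ≤ n) (hg : 8 * n ≤ 2 ^ g) :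
    (2 : ℝ) ^ n * (2 ^ n * (2 ^ k * (4 ^ n * (n * 2)))) * (3 * Real.exp (-2 ^ g)) < 1 := by
  have h1 : Real.exp (-2 ^ g) ≤ (Real.exp (8 * n))⁻¹ := by
    rw [← Real.exp_neg, Real.exp_le_exp]
    have : (8 * n : ℝ) ≤ 2 ^ g := by exact_mod_cast hg
    linarith
  have h2 : (2 : ℝ) ^ (8 * n) < Real.exp (8 * n) := by
    have : Real.exp (8 * n) = Real.exp 1 ^ (8 * n) := by rw [← Real.exp_nat_mul]; simp
    rw [this]
    exact pow_lt_pow_left₀ (by linarith [Real.exp_one_gt_d9]) (by norm_num) (by omega)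
  have h3 : (6 * n : ℝ) ≤ 2 ^ (3 * n) := by
    have := one_add_mul_le_pow (a := (7 : ℝ)) (by norm_num) n
    rw [pow_mul]; norm_num at this ⊢; linarith
  have h4 : (2 : ℝ) ^ k ≤ 2 ^ n := pow_le_pow_right₀ (by norm_num) hk
  calc (2 : ℝ) ^ n * (2 ^ n * (2 ^ k * (4 ^ n * (n * 2)))) * (3 * Real.exp (-2 ^ g))
      = (2 ^ n * 2 ^ n * 4 ^ n) * 2 ^ k * (6 * n) * Real.exp (-2 ^ g) := by ring
    _ ≤ (2 ^ n * 2 ^ n * 4 ^ n) * 2 ^ n * 2 ^ (3 * n) * (Real.exp (8 * n))⁻¹ := by gcongr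
    _ = 2 ^ (8 * n) * (Real.exp (8 * n))⁻¹ := by
      rw [show (4 : ℝ) = 2 ^ 2 by norm_num, ← pow_mul]; ring
    _ < 1 := by rw [← div_eq_mul_inv, div_lt_one (Real.exp_pos _)]; exact h2

theorem exists_isPseudorandom {n r k g : ℕ} (hn : 1 ≤ n) (hg : 2 ≤ g) (hrk : r + k + 8 * g ≤ n)
    (hng : 8 * n ≤ 2 ^ g) :
    ∃ L : Word n → Option (Word k), IsPseudorandom r g L := by
  set p : ℝ := (2 ^ (k + g))⁻¹ with hp
  set δ : ℝ := (2 ^ g)⁻¹ with hδ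
  have hp0 : 0 < p := by positivity
  have hδ0 : 0 < δ := by positivity
  have hδ1 : δ ≤ 1 := inv_le_one_of_one_le₀ (one_le_pow₀ (by norm_num))
  set F : ℝ := 2 ^ (n - r - 2 * g) with hF
  have hF0 : 0 < F := by positivity
  -- the expected number of codewords in a cube of codimension at most `r + 2 * g`
  have hpF : (2 ^ g) ^ 5 ≤ p * F := by
    rw [hp, hF, ← pow_mul, inv_mul_eq_div, le_div_iff₀ (by positivity), ← pow_add]
    exact pow_le_pow_right₀ (by norm_num) (by omega)
  have hg4 : (4 : ℝ) ≤ 2 ^ g := by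
    calc (4 : ℝ) = 2 ^ 2 := by norm_num
      _ ≤ 2 ^ g := pow_le_pow_right₀ (by norm_num) hg
  have hgδ : (2 : ℝ) ^ g * δ = 1 := mul_inv_cancel₀ (by positivity)
  have hpF1 : 1 ≤ p * F := (one_le_pow₀ (by linarith)).trans hpF
  set θ : ℝ := (2 * (p * F))⁻¹ with hθ
  have hθ0 : 0 < θ := by positivity
  have hθF : 2 * p * θ * F = 1 := by rw [hθ]; field_simp
  have hθ1 : θ ≤ 1 := inv_le_one_of_one_le₀ (by linarith)
  have hw := labelWeight_nonneg k g
  have hw1 := sum_labelWeight k g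
  have hwm : ∀ m, labelWeight k g (some m) = p := fun _ => rfl
  let G : Finset (Option (Word k)) := Finset.univ.map Function.Embedding.some
  have hGq : ∑ l ∈ G, labelWeight k g l = δ := by
    simpa [G] using sum_labelWeight_some k g
  have hGm : ∀ l, l ∈ G ↔ l ≠ none := by
    intro l; cases l <;> simp [G]
  have hη : (0 : ℝ) ≤ Real.exp (-2 ^ g) := (Real.exp_pos _).le
  let dev : ℝ → Finset (Fin n) → Word n → Word k → (Word n → Option (Word k)) → ℝ :=
    fun t S a m L => Real.exp (t * (((cube S a).filter fun x => L x = some m).card -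
      p * (cube S a).card) - δ ^ 2 / 2 * (p * (cube S a).card))
  let src : Finset (Fin n) → Word n → (Fin n → Bool → Bool) → Fin n → Bool → Finset (Word n) :=
    fun S a h i b => (cube S a).filter fun x => x i = b ∧ h i (x i) ≠ b
  let pairs : Finset (Fin n) → Word n → Word k → (Fin n → Bool → Bool) → Fin n → Bool →
      (Word n → Option (Word k)) → ℝ := fun S a m h i b L =>
    Real.exp (θ * ((src S a h i b).filter fun x => L x = some m ∧ L (bitwise h x) ∈ G).card) *
      Real.exp (-(θ * (8 * δ * p * (cube S a).card)))
  have hdev : ∀ t, |t| = δ / 2 → ∀ S a m, S.card ≤ r + 2 * g →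
      labelExp (labelWeight k g) (dev t S a m) ≤ Real.exp (-2 ^ g) := by
    intro t ht S a m hS
    refine (labelExp_chernoff hw hw1 (cube S a) (some m) ht hδ1).trans ?_
    rw [Real.exp_le_exp, neg_le_neg_iff, hwm]
    have hc : F ≤ (cube S a).card := by
      rw [card_cube]; push_cast
      exact pow_le_pow_right₀ (by norm_num) (by omega)
    have h1 : (2 ^ g) ^ 5 ≤ p * (cube S a).card :=
      hpF.trans (mul_le_mul_of_nonneg_left hc hp0.le)
    have h2 := mul_le_mul_of_nonneg_right h1 (sq_nonneg δ)
    have h3 : ((2 : ℝ) ^ g) ^ 5 * δ ^ 2 = (2 ^ g) ^ 3 := by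
      calc ((2 : ℝ) ^ g) ^ 5 * δ ^ 2 = (2 ^ g) ^ 3 * (2 ^ g * δ) ^ 2 := by ring
        _ = _ := by rw [hgδ]; ring
    nlinarith [mul_le_mul hg4 hg4 (by norm_num) (by positivity)]
  have hpairs : ∀ S a m h i b, S.card = r → r + 2 * g < (S ∪ freeCoords h).card →
      labelExp (labelWeight k g) (pairs S a m h i b) ≤ Real.exp (-2 ^ g) := by
    intro S a m h i b hS hT
    have hsrc : ∀ x ∈ src S a h i b, x i = b ∧ ¬ bitwise h x i = b := by
      intro x hx; exact (Finset.mem_filter.1 hx).2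
    have hsub : src S a h i b ⊆ cube S a := Finset.filter_subset _ _
    rw [labelExp_mul_const]
    refine (mul_le_mul_of_nonneg_right (labelExp_exp_card_pairs_le hw hw1 (fun x => x i = b)
      (src S a h i b) (bitwise h) hsrc (some m) G hθ0.le hθ1 fun y => ?_)
      (Real.exp_pos _).le).trans ?_
    · rw [hwm, ← hθF]
      gcongr
      have h1 := (Finset.card_le_card (Finset.filter_subset_filter
        (fun x => bitwise h x = y) hsub)).trans (card_fiber_le y)
      have h2 : 2 ^ (n - (S ∪ freeCoords h).card) ≤ 2 ^ (n - r - 2 * g) :=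
        Nat.pow_le_pow_right (by norm_num) (by omega)
      rw [hF]
      exact_mod_cast h1.trans h2
    · rw [← Real.exp_add, Real.exp_le_exp, hGq, hwm]
      have h1 : ((src S a h i b).card : ℝ) ≤ (cube S a).card := by
        exact_mod_cast Finset.card_le_card hsub
      have h2 := mul_le_mul_of_nonneg_left h1 (show 0 ≤ 4 * δ * p * θ by positivity)
      have h3 : ((cube S a).card : ℝ) = (2 ^ g) ^ 2 * F := by
        rw [card_cube, hF, hS, ← pow_mul, ← pow_add]
        push_cast
        congr 1; omega
      have h4 : 4 * δ * p * θ * (cube S a).card = 2 * 2 ^ g := by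
        calc 4 * δ * p * θ * (cube S a).card
            = 2 * (2 ^ g * δ) * (2 * p * θ * F) * 2 ^ g := by rw [h3]; ring
          _ = _ := by rw [hgδ, hθF]; ring
      linarith
  obtain ⟨L, hL⟩ := exists_labelling_forall_lt_one
    (J := Finset (Fin n) × Word n × Word k × (Fin n → Bool → Bool) × Fin n × Bool)
    (η := 3 * Real.exp (-2 ^ g)) hw hw1
    (fun ⟨S, a, m, h, i, b⟩ L =>
      (if S.card ≤ r + 2 * g then dev (δ / 2) S a m L else 0) +
      (if S.card ≤ r + 2 * g then dev (-(δ / 2)) S a m L else 0) +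
      (if S.card = r ∧ r + 2 * g < (S ∪ freeCoords h).card then pairs S a m h i b L else 0))
    (fun ⟨S, a, m, h, i, b⟩ L => by dsimp only [dev, pairs]; positivity)
    (fun ⟨S, a, m, h, i, b⟩ => by
      rw [labelExp_add, labelExp_add]
      have e1 := labelExp_ite_le (S.card ≤ r + 2 * g) _ hη
        (hdev (δ / 2) (abs_of_nonneg (by positivity)) S a m)
      have e2 := labelExp_ite_le (S.card ≤ r + 2 * g) _ hη
        (hdev (-(δ / 2)) (by rw [abs_neg, abs_of_nonneg (by positivity)]) S a m)
      have e3 := labelExp_ite_le (S.card = r ∧ r + 2 * g < (S ∪ freeCoords h).card) _ hη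
        (fun hc => hpairs S a m h i b hc.1 hc.2)
      linarith)
    (by
      have := exp_union_bound hn (show k ≤ n by omega) hng
      simpa only [Fintype.card_prod, Fintype.card_finset, Fintype.card_fun, Fintype.card_fin,
        Fintype.card_bool, Nat.cast_mul, Nat.cast_pow, Nat.cast_ofNat,
        show (2 : ℝ) ^ 2 = 4 by norm_num] using this)
  have hdev0 : ∀ t S a m, 0 ≤ dev t S a m L := fun _ _ _ _ => (Real.exp_pos _).le
  have hpairs0 : ∀ S a m h i b, 0 ≤ pairs S a m h i b L :=
    fun _ _ _ _ _ _ => (mul_pos (Real.exp_pos _) (Real.exp_pos _)).le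
  refine ⟨L, ⟨fun S a m hS => ?_, fun S a h i b m hS hT => ?_⟩⟩
  · have := hL ⟨S, a, m, fun _ => id, ⟨0, hn⟩, true⟩
    simp only [hS, if_true] at this
    have h0 : 0 ≤ if S.card = r ∧ r + 2 * g < (S ∪ freeCoords fun _ => id).card then
      pairs S a m (fun _ => id) ⟨0, hn⟩ true L else 0 := by split_ifs; exacts [hpairs0 .., le_rfl]
    have h1 : dev (δ / 2) S a m L < 1 := by linarith [hdev0 (-(δ / 2)) S a m]
    have h2 : dev (-(δ / 2)) S a m L < 1 := by linarith [hdev0 (δ / 2) S a m]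
    simp only [dev, Real.exp_lt_one_iff] at h1 h2
    rw [abs_le]
    constructor
    · by_contra! hlt
      nlinarith
    · by_contra! hlt
      nlinarith
  · have := hL ⟨S, a, m, h, i, b⟩
    simp only [hS, hT, and_self, if_true] at this
    have h0 : ∀ t, 0 ≤ if r ≤ r + 2 * g then dev t S a m L else 0 := by
      intro t; split_ifs; exacts [hdev0 .., le_rfl]
    have h1 : pairs S a m h i b L < 1 := by linarith [h0 (δ / 2), h0 (-(δ / 2))]
    simp only [pairs, src, ← Real.exp_add, Real.exp_lt_one_iff, hGm, Finset.filter_filter] at h1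
    by_contra! hlt
    linarith [mul_le_mul_of_nonneg_left hlt.le hθ0.le]

section StatisticalDistance

variable {V Z : Type*}

theorem toReal_map_apply [Fintype V] [DecidableEq Z] (X : PMF V) (φ : V → Z) (z : Z) :
    ((X.map φ) z).toReal = ∑ x with φ x = z, (X x).toReal := by
  rw [PMF.map_apply, tsum_fintype, ENNReal.toReal_sum, Finset.sum_filter]
  · refine Finset.sum_congr rfl fun x _ => ?_
    by_cases h : φ x = z
    · simp [h]
    · simp [h, Ne.symm h]
  · intro x _
    split_ifs
    exacts [X.apply_ne_top x, ENNReal.zero_ne_top]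

theorem SD_comm [Fintype Z] (X Y : PMF Z) : SD X Y = SD Y X := by
  simp only [SD, abs_sub_comm]

theorem SD_triangle [Fintype Z] (X Y W : PMF Z) : SD X W ≤ SD X Y + SD Y W := by
  rw [SD, SD, SD, ← mul_add, ← Finset.sum_add_distrib]
  gcongr
  exact abs_sub_le _ _ _

variable [Fintype Z] [DecidableEq Z]

/-- Data processing for signed weights. -/
theorem sum_abs_fiber_le {W : Type*} [Fintype W] [DecidableEq W] (A : Finset V) (d : V → ℝ)
    (κ : V → W) (Ψ : V → Z) (φ : W → Z) (hφ : ∀ x ∈ A, Ψ x = φ (κ x)) :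
    ∑ z, |∑ x ∈ A with Ψ x = z, d x| ≤ ∑ v, |∑ x ∈ A with κ x = v, d x| := by
  have h1 : ∀ z, ∑ x ∈ A with Ψ x = z, d x =
      ∑ v with φ v = z, ∑ x ∈ A with κ x = v, d x := by
    intro z
    rw [← Finset.sum_fiberwise_of_maps_to (s := A.filter fun x => Ψ x = z)
      (t := Finset.univ.filter fun v => φ v = z) (g := κ)]
    · refine Finset.sum_congr rfl fun v hv => Finset.sum_congr ?_ fun _ _ => rfl
      ext x
      simp only [Finset.mem_filter, Finset.mem_univ, true_and] at hv ⊢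
      constructor
      · rintro ⟨⟨a, _⟩, c⟩; exact ⟨a, c⟩
      · rintro ⟨a, c⟩; exact ⟨⟨a, by rw [hφ x a, c, hv]⟩, c⟩
    · intro x hx
      simp only [Finset.mem_filter, Finset.mem_univ, true_and] at hx ⊢
      rw [← hφ x hx.1, hx.2]
  calc ∑ z, |∑ x ∈ A with Ψ x = z, d x|
      ≤ ∑ z, ∑ v with φ v = z, |∑ x ∈ A with κ x = v, d x| := by
        refine Finset.sum_le_sum fun z _ => ?_
        rw [h1 z]
        exact Finset.abs_sum_le_sum_abs _ _
    _ = _ := Finset.sum_fiberwise _ _ _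

theorem sum_abs_fiber_le_sum_abs [Fintype V] [DecidableEq V] (d : V → ℝ) (Ψ : V → Z) :
    ∑ z, |∑ x with Ψ x = z, d x| ≤ ∑ x, |d x| := by
  have := sum_abs_fiber_le Finset.univ d id Ψ Ψ fun _ _ => rfl
  simpa [Finset.filter_eq'] using this

theorem SD_map_map_le [Fintype V] (X : PMF V) (φ ψ : V → Z) :
    SD (X.map φ) (X.map ψ) ≤ ∑ x with φ x ≠ ψ x, (X x).toReal := by
  classical
  have h : ∀ z, (∑ x with φ x = z, (X x).toReal) - ∑ x with ψ x = z, (X x).toReal =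
      (∑ x with φ x = z, if φ x ≠ ψ x then (X x).toReal else 0) -
        ∑ x with ψ x = z, if φ x ≠ ψ x then (X x).toReal else 0 := by
    intro z
    simp only [Finset.sum_filter, ← Finset.sum_sub_distrib]
    refine Finset.sum_congr rfl fun x _ => ?_
    by_cases hx : φ x = ψ x <;> simp [hx]
  have h1 := sum_abs_fiber_le_sum_abs (fun x => if φ x ≠ ψ x then (X x).toReal else 0) φ
  have h2 := sum_abs_fiber_le_sum_abs (fun x => if φ x ≠ ψ x then (X x).toReal else 0) ψ
  have h3 : ∑ x, |if φ x ≠ ψ x then (X x).toReal else 0| =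
      ∑ x with φ x ≠ ψ x, (X x).toReal := by
    rw [Finset.sum_filter]
    refine Finset.sum_congr rfl fun x _ => ?_
    split_ifs <;> simp
  rw [h3] at h1 h2
  rw [SD]
  simp only [toReal_map_apply, h]
  have h4 := (Finset.sum_le_sum fun z (_ : z ∈ Finset.univ) => abs_sub
    (∑ x with φ x = z, if φ x ≠ ψ x then (X x).toReal else 0)
    (∑ x with ψ x = z, if φ x ≠ ψ x then (X x).toReal else 0))
  rw [Finset.sum_add_distrib] at h4
  linarith

end StatisticalDistance

/-- Extension by `false` of a partial word. -/
def extendWord {n : ℕ} {S : Finset (Fin n)} (α : {i : Fin n // i ∈ S} → Bool) : Word n :=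
  fun i => if h : i ∈ S then α ⟨i, h⟩ else false

theorem filter_restrict_eq_cube {n : ℕ} {S : Finset (Fin n)} (α : {i : Fin n // i ∈ S} → Bool) :
    (Finset.univ.filter fun x : Word n => (fun j : {i : Fin n // i ∈ S} => x j.1) = α) =
      cube S (extendWord α) := by
  ext x
  simp only [Finset.mem_filter, Finset.mem_univ, true_and, mem_cube, funext_iff, extendWord,
    Subtype.forall]
  exact forall_congr' fun i => forall_congr' fun hi => by simp [hi]

/-- Density of label `m`, normalised by its expectation, minus the uniform density. -/
noncomputable def discrepancy {n k : ℕ} (g : ℕ) (L : Word n → Option (Word k)) (m : Word k)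
    (x : Word n) : ℝ :=
  ((if L x = some m then 2 ^ (k + g) else 0) - 1) / 2 ^ n

theorem sum_discrepancy {n k : ℕ} (g : ℕ) (L : Word n → Option (Word k)) (m : Word k)
    (B : Finset (Word n)) :
    ∑ x ∈ B, discrepancy g L m x =
      (((B.filter fun x => L x = some m).card : ℝ) * 2 ^ (k + g) - B.card) / 2 ^ n := by
  simp only [discrepancy, ← Finset.sum_div, Finset.sum_sub_distrib, Finset.sum_const,
    nsmul_eq_mul, mul_one, ← Finset.sum_filter]

namespace IsPseudorandom

variable {n k r g : ℕ} {L : Word n → Option (Word k)}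

theorem abs_sum_discrepancy_cube_le (hL : IsPseudorandom r g L) (m : Word k)
    {S : Finset (Fin n)} (a : Word n) (hS : S.card ≤ r + 2 * g) :
    |∑ x ∈ cube S a, discrepancy g L m x| ≤ (2 ^ g)⁻¹ * ((cube S a).card / 2 ^ n) := by
  rw [sum_discrepancy, abs_div, abs_of_pos (show (0 : ℝ) < 2 ^ n by positivity), ← mul_div_assoc]
  gcongr
  have h := mul_le_mul_of_nonneg_right (hL.cube_count S a m hS)
    (show (0 : ℝ) ≤ 2 ^ (k + g) by positivity)
  have hne : (2 : ℝ) ^ (k + g) ≠ 0 := by positivity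
  rw [← abs_of_pos (show (0 : ℝ) < 2 ^ (k + g) by positivity), ← abs_mul, sub_mul,
    abs_of_pos (show (0 : ℝ) < 2 ^ (k + g) by positivity), mul_right_comm _ _ ((2 : ℝ) ^ (k + g)),
    inv_mul_cancel₀ hne, one_mul, mul_assoc, mul_right_comm _ _ ((2 : ℝ) ^ (k + g)),
    inv_mul_cancel₀ hne, one_mul] at h
  exact h

theorem abs_sum_discrepancy_cube_le_of_le (hL : IsPseudorandom r g L) (m : Word k)
    {S : Finset (Fin n)} (a : Word n) (hS : r ≤ S.card) :
    |∑ x ∈ cube S a, discrepancy g L m x| ≤ 2 * (2 ^ g)⁻¹ * (2 ^ r)⁻¹ := by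
  have hδ1 : ((2 : ℝ) ^ g)⁻¹ ≤ 1 := inv_le_one_of_one_le₀ (one_le_pow₀ (by norm_num))
  have hδ0 : (0 : ℝ) < (2 ^ g)⁻¹ := by positivity
  have hr0 : (0 : ℝ) < (2 ^ r)⁻¹ := by positivity
  by_cases hS2 : S.card ≤ r + 2 * g
  · refine (hL.abs_sum_discrepancy_cube_le m a hS2).trans ?_
    rw [card_cube_div]
    have : ((2 : ℝ) ^ S.card)⁻¹ ≤ (2 ^ r)⁻¹ :=
      inv_anti₀ (by positivity) (pow_le_pow_right₀ (by norm_num) hS)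
    nlinarith
  · obtain ⟨T, hTS, hT⟩ := Finset.exists_subset_card_eq (show r + 2 * g ≤ S.card by omega)
    have h1 := (abs_le.1 (hL.abs_sum_discrepancy_cube_le m a hT.le)).2
    have hcard := card_cube_div T a
    have hST := cube_subset_cube hTS a
    have h2 : ((cube S a).card : ℝ) ≤ (cube T a).card := by
      exact_mod_cast Finset.card_le_card hST
    have h3 : (((cube S a).filter fun x => L x = some m).card : ℝ) ≤
        ((cube T a).filter fun x => L x = some m).card := by
      exact_mod_cast Finset.card_le_card (Finset.filter_subset_filter _ hST)
    rw [hT, pow_add, two_mul, pow_add, mul_inv, mul_inv] at hcard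
    rw [sum_discrepancy, sub_div] at h1 ⊢
    rw [hcard] at h1
    have h4 : ((cube S a).card : ℝ) / 2 ^ n ≤ (2 ^ r)⁻¹ * ((2 ^ g)⁻¹ * (2 ^ g)⁻¹) := by
      rw [← hcard]; gcongr
    have h5 : (((cube S a).filter fun x => L x = some m).card : ℝ) * 2 ^ (k + g) / 2 ^ n ≤
        ((cube T a).filter fun x => L x = some m).card * 2 ^ (k + g) / 2 ^ n := by gcongr
    have h6 : (0 : ℝ) ≤ ((cube S a).card : ℝ) / 2 ^ n := by positivity
    have h7 : (0 : ℝ) ≤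
      (((cube S a).filter fun x => L x = some m).card : ℝ) * 2 ^ (k + g) / 2 ^ n := by positivity
    have h8 : ((2 : ℝ) ^ r)⁻¹ * ((2 ^ g)⁻¹ * (2 ^ g)⁻¹) ≤ (2 ^ r)⁻¹ * (2 ^ g)⁻¹ := by
      gcongr; nlinarith
    have h9 : ((2 : ℝ) ^ g)⁻¹ * ((2 ^ r)⁻¹ * ((2 ^ g)⁻¹ * (2 ^ g)⁻¹)) ≤
        1 * ((2 ^ r)⁻¹ * (2 ^ g)⁻¹) := by gcongr
    rw [abs_le]
    constructor <;> linarith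

theorem sum_abs_discrepancy_fiber_le (hL : IsPseudorandom r g L) (m : Word k)
    {S : Finset (Fin n)} (a : Word n) (h : Fin n → Bool → Bool)
    (hS : (S ∪ freeCoords h).card ≤ r + 2 * g) :
    ∑ y, |∑ x ∈ cube S a with bitwise h x = y, discrepancy g L m x| ≤
      (2 ^ g)⁻¹ * (2 ^ S.card)⁻¹ := by
  calc _ ≤ ∑ y, (2 ^ g)⁻¹ * (((((cube S a).filter fun x => bitwise h x = y).card : ℕ) : ℝ) /
        2 ^ n) := by
        refine Finset.sum_le_sum fun y _ => ?_
        rcases ((cube S a).filter fun x => bitwise h x = y).eq_empty_or_nonempty with h0 | ⟨x₀, hx⟩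
        · simp [h0]
        · obtain ⟨hx₀, rfl⟩ := Finset.mem_filter.1 hx
          rw [fiber_eq_cube hx₀]
          exact hL.abs_sum_discrepancy_cube_le m x₀ hS
    _ = _ := by
        rw [← Finset.mul_sum, ← Finset.sum_div, ← Nat.cast_sum,
          ← Finset.card_eq_sum_card_fiberwise (by intro x; simp), card_cube_div]

theorem sum_abs_discrepancy_fixed_le (hL : IsPseudorandom r g L) (m : Word k)
    {S : Finset (Fin n)} (a : Word n) (h : Fin n → Bool → Bool) (hS : S.card = r) :
    ∑ b : Bool, |∑ x ∈ cube S a with decide (bitwise h x = x) = b, discrepancy g L m x| ≤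
      6 * (2 ^ g)⁻¹ * (2 ^ r)⁻¹ := by
  have h1 := hL.abs_sum_discrepancy_cube_le_of_le m a hS.ge
  have h2 : |∑ x ∈ cube S a with bitwise h x = x, discrepancy g L m x| ≤
      2 * (2 ^ g)⁻¹ * (2 ^ r)⁻¹ := by
    rcases ((cube S a).filter fun x => bitwise h x = x).eq_empty_or_nonempty with h0 | ⟨x₀, hx⟩
    · rw [h0]; simp
    · obtain ⟨hx₀, hfix⟩ := Finset.mem_filter.1 hx
      rw [fixed_eq_cube hx₀ hfix]
      exact hL.abs_sum_discrepancy_cube_le_of_le m x₀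
        (hS ▸ Finset.card_le_card Finset.subset_union_left)
  have h3 := Finset.sum_filter_add_sum_filter_not (cube S a) (fun x => bitwise h x = x)
    (discrepancy g L m)
  simp only [Fintype.sum_bool, decide_eq_true_eq, decide_eq_false_iff_not]
  rw [← h3] at h1
  have h4 := abs_sub (∑ x ∈ cube S a with bitwise h x = x, discrepancy g L m x +
    ∑ x ∈ cube S a with ¬ bitwise h x = x, discrepancy g L m x)
    (∑ x ∈ cube S a with bitwise h x = x, discrepancy g L m x)
  rw [add_sub_cancel_left] at h4
  linarith

end IsPseudorandom

section Code

variable {n k r g : ℕ} {L : Word n → Option (Word k)}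

/-- The encoder choosing a uniform word with the label of the message. -/
noncomputable def labelEnc (L : Word n → Option (Word k))
    (hne : ∀ m, (Finset.univ.filter fun x => L x = some m).Nonempty) (m : Word k) :
    PMF (Word n) :=
  PMF.uniformOfFinset _ (hne m)

theorem labelEnc_apply
    (hne : ∀ m, (Finset.univ.filter fun x => L x = some m).Nonempty) (m : Word k) (x : Word n) :
    (labelEnc L hne m x).toReal =
      if L x = some m then ((Finset.univ.filter fun x => L x = some m).card : ℝ)⁻¹ else 0 := by
  simp only [labelEnc, PMF.uniformOfFinset_apply, Finset.mem_filter, Finset.mem_univ, true_and]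
  split_ifs <;> simp

theorem labelEnc_correct
    (hne : ∀ m, (Finset.univ.filter fun x => L x = some m).Nonempty) :
    Correct (labelEnc L hne) L := by
  intro m c hc
  simpa [labelEnc] using hc

namespace IsPseudorandom

theorem abs_card_sub_le (hL : IsPseudorandom r g L) (m : Word k) :
    |((Finset.univ.filter fun x => L x = some m).card : ℝ) - (2 ^ (k + g))⁻¹ * 2 ^ n| ≤
      (2 ^ g)⁻¹ * ((2 ^ (k + g))⁻¹ * 2 ^ n) := by
  have h := hL.cube_count ∅ (fun _ => false) m (by simp)
  rw [card_cube] at h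
  simpa [cube] using h

theorem half_le_card (hL : IsPseudorandom r g L) (hg : 1 ≤ g) (m : Word k) :
    (2 ^ (k + g))⁻¹ * 2 ^ n / 2 ≤ ((Finset.univ.filter fun x => L x = some m).card : ℝ) := by
  have h := (abs_le.1 (hL.abs_card_sub_le m)).1
  have hδ : ((2 : ℝ) ^ g)⁻¹ ≤ 1 / 2 := by
    rw [one_div]
    exact inv_anti₀ (by norm_num) (le_self_pow₀ (by norm_num) (by omega))
  have : (0 : ℝ) < (2 ^ (k + g))⁻¹ * 2 ^ n := by positivity
  nlinarith

theorem nonempty (hL : IsPseudorandom r g L) (hg : 1 ≤ g) (m : Word k) :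
    (Finset.univ.filter fun x => L x = some m).Nonempty := by
  have h := hL.half_le_card hg m
  have : (0 : ℝ) < (2 ^ (k + g))⁻¹ * 2 ^ n / 2 := by positivity
  rw [← Finset.card_pos]
  exact_mod_cast this.trans_le h

/-- Statistics of an encoding are close to those of a uniform word, up to the discrepancy. -/
theorem SD_map_labelEnc_uniform_le (hL : IsPseudorandom r g L) (hg : 1 ≤ g) (m : Word k)
    {Z : Type*} [Fintype Z] [DecidableEq Z] (Ψ : Word n → Z) :
    SD ((labelEnc L (hL.nonempty hg) m).map Ψ) ((PMF.uniformOfFintype (Word n)).map Ψ) ≤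
      ((2 ^ g)⁻¹ + ∑ z, |∑ x with Ψ x = z, discrepancy g L m x|) / 2 := by
  set M : ℝ := ((Finset.univ.filter fun x => L x = some m).card : ℝ) with hM
  set e : Word n → ℝ := fun x => (labelEnc L (hL.nonempty hg) m x).toReal -
    if L x = some m then 2 ^ (k + g) / 2 ^ n else 0 with he
  have hM0 : 0 < M := lt_of_lt_of_le (by positivity) (hL.half_le_card hg m)
  have h1 : ∀ z, (∑ x with Ψ x = z, (labelEnc L (hL.nonempty hg) m x).toReal) -
      ∑ x with Ψ x = z, (PMF.uniformOfFintype (Word n) x).toReal =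
      (∑ x with Ψ x = z, e x) + ∑ x with Ψ x = z, discrepancy g L m x := by
    intro z
    rw [← Finset.sum_sub_distrib, ← Finset.sum_add_distrib]
    refine Finset.sum_congr rfl fun x _ => ?_
    simp only [he, discrepancy, PMF.uniformOfFintype_apply]
    split_ifs <;> simp <;> ring
  have h2 : ∑ x, |e x| ≤ (2 ^ g)⁻¹ := by
    have : ∀ x, |e x| = if L x = some m then |M⁻¹ - 2 ^ (k + g) / 2 ^ n| else 0 := by
      intro x
      simp only [he, labelEnc_apply]
      split_ifs <;> simp [hM]
    simp only [this]
    rw [← Finset.sum_filter, Finset.sum_const, nsmul_eq_mul, ← hM]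
    nth_rw 1 [← abs_of_pos hM0]
    rw [← abs_mul, mul_sub, mul_inv_cancel₀ hM0.ne']
    have h := mul_le_mul_of_nonneg_right (hL.abs_card_sub_le m)
      (show (0 : ℝ) ≤ 2 ^ (k + g) / 2 ^ n by positivity)
    have hc : ((2 : ℝ) ^ (k + g))⁻¹ * 2 ^ n * (2 ^ (k + g) / 2 ^ n) = 1 := by field_simp
    rw [← abs_of_pos (show (0 : ℝ) < 2 ^ (k + g) / 2 ^ n by positivity), ← abs_mul, sub_mul,
      abs_of_pos (show (0 : ℝ) < 2 ^ (k + g) / 2 ^ n by positivity), hc, mul_assoc, hc,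
      mul_one, abs_sub_comm] at h
    exact h
  rw [SD]
  simp only [toReal_map_apply, h1]
  have h3 := Finset.sum_le_sum fun z (_ : z ∈ Finset.univ) => abs_add_le
    (∑ x with Ψ x = z, e x) (∑ x with Ψ x = z, discrepancy g L m x)
  rw [Finset.sum_add_distrib] at h3
  linarith [sum_abs_fiber_le_sum_abs e Ψ]

theorem secrecy (hL : IsPseudorandom r g L) (hg : 1 ≤ g) {S : Finset (Fin n)}
    (hS : S.card ≤ r) (m₀ m₁ : Word k) :
    SD (restrictPMF S (labelEnc L (hL.nonempty hg) m₀))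
      (restrictPMF S (labelEnc L (hL.nonempty hg) m₁)) ≤ 2 * (2 ^ g)⁻¹ := by
  let Ψ : Word n → {i : Fin n // i ∈ S} → Bool := fun x j => x j.1
  have key : ∀ m, SD ((labelEnc L (hL.nonempty hg) m).map Ψ)
      ((PMF.uniformOfFintype (Word n)).map Ψ) ≤ (2 ^ g)⁻¹ := by
    intro m
    refine (hL.SD_map_labelEnc_uniform_le hg m Ψ).trans ?_
    have : ∑ z, |∑ x with Ψ x = z, discrepancy g L m x| ≤
        ∑ _z : {i : Fin n // i ∈ S} → Bool, (2 ^ g)⁻¹ * (2 ^ S.card)⁻¹ := by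
      refine Finset.sum_le_sum fun z _ => ?_
      rw [filter_restrict_eq_cube, ← card_cube_div S (extendWord z)]
      exact hL.abs_sum_discrepancy_cube_le m _ (by omega)
    rw [Finset.sum_const, nsmul_eq_mul] at this
    simp only [Finset.card_univ, Fintype.card_fun, Fintype.card_bool, Fintype.card_coe,
      Nat.cast_pow, Nat.cast_ofNat] at this
    rw [mul_left_comm, mul_inv_cancel₀ (by positivity), mul_one] at this
    linarith
  have h := SD_triangle ((labelEnc L (hL.nonempty hg) m₀).map Ψ)
    ((PMF.uniformOfFintype (Word n)).map Ψ) ((labelEnc L (hL.nonempty hg) m₁).map Ψ)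
  rw [SD_comm ((PMF.uniformOfFintype (Word n)).map Ψ)] at h
  have h0 := key m₀
  have h1 := key m₁
  change SD ((labelEnc L (hL.nonempty hg) m₀).map Ψ) ((labelEnc L (hL.nonempty hg) m₁).map Ψ) ≤ _
  linarith

/-- The ideal outcome of tampering with an encoding of `m`: on views leaving few free coordinates
the tampered word is decoded, and on the other views only being a fixed point is observed. -/
def idealOutcome (r g : ℕ) (L : Word n → Option (Word k)) {S : Finset (Fin n)}
    (h : ({i : Fin n // i ∈ S} → Bool) → Fin n → Bool → Bool) (m : Word k) (x : Word n) :
    Option (Word k) :=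
  if (S ∪ freeCoords (h fun j => x j.1)).card ≤ r + 2 * g then
    L (bitwise (h fun j => x j.1) x)
  else if bitwise (h fun j => x j.1) x = x then some m else none

theorem sum_abs_discrepancy_idealOutcome_le (hL : IsPseudorandom r g L) {S : Finset (Fin n)}
    (hS : S.card = r) (h : ({i : Fin n // i ∈ S} → Bool) → Fin n → Bool → Bool) (m : Word k) :
    ∑ z, |∑ x with idealOutcome r g L h m x = z, discrepancy g L m x| ≤ 6 * (2 ^ g)⁻¹ := by
  have hcell : ∀ α : {i : Fin n // i ∈ S} → Bool,
      ∑ z, |∑ x ∈ cube S (extendWord α) with idealOutcome r g L h m x = z,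
        discrepancy g L m x| ≤ 6 * (2 ^ g)⁻¹ * (2 ^ r)⁻¹ := by
    intro α
    have hα : ∀ x ∈ cube S (extendWord α), (fun j : {i : Fin n // i ∈ S} => x j.1) = α := by
      intro x hx
      rw [← filter_restrict_eq_cube] at hx
      exact (Finset.mem_filter.1 hx).2
    by_cases hc : (S ∪ freeCoords (h α)).card ≤ r + 2 * g
    · refine (sum_abs_fiber_le _ _ (bitwise (h α)) _ L fun x hx => ?_).trans
        ((hL.sum_abs_discrepancy_fiber_le m (extendWord α) (h α) hc).trans ?_)
      · simp only [idealOutcome, hα x hx, hc, if_true]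
      · rw [hS]
        have : (0 : ℝ) ≤ (2 ^ g)⁻¹ * (2 ^ r)⁻¹ := by positivity
        linarith
    · refine (sum_abs_fiber_le _ _ (fun x => decide (bitwise (h α) x = x)) _
        (fun b => if b then some m else none) fun x hx => ?_).trans
        (hL.sum_abs_discrepancy_fixed_le m (extendWord α) (h α) hS)
      simp only [idealOutcome, hα x hx, hc, if_false, decide_eq_true_eq]
  calc _ ≤ ∑ z, ∑ α : {i : Fin n // i ∈ S} → Bool,
        |∑ x ∈ cube S (extendWord α) with idealOutcome r g L h m x = z,
          discrepancy g L m x| := by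
        refine Finset.sum_le_sum fun z _ => ?_
        rw [← Finset.sum_fiberwise (Finset.univ.filter fun x => idealOutcome r g L h m x = z)
          (fun x (j : {i : Fin n // i ∈ S}) => x j.1)]
        simp only [Finset.filter_comm (fun x => idealOutcome r g L h m x = z),
          filter_restrict_eq_cube]
        exact Finset.abs_sum_le_sum_abs _ _
    _ = ∑ α : {i : Fin n // i ∈ S} → Bool, ∑ z,
        |∑ x ∈ cube S (extendWord α) with idealOutcome r g L h m x = z,
          discrepancy g L m x| := Finset.sum_comm
    _ ≤ ∑ _α : {i : Fin n // i ∈ S} → Bool, 6 * (2 ^ g)⁻¹ * (2 ^ r)⁻¹ :=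
        Finset.sum_le_sum fun α _ => hcell α
    _ = _ := by
        simp only [Finset.sum_const, nsmul_eq_mul, Finset.card_univ, Fintype.card_fun,
          Fintype.card_bool, Fintype.card_coe, hS, Nat.cast_pow, Nat.cast_ofNat]
        field_simp

theorem card_ne_idealOutcome_le (hL : IsPseudorandom r g L) {S : Finset (Fin n)}
    (hS : S.card = r) (h : ({i : Fin n // i ∈ S} → Bool) → Fin n → Bool → Bool) (m : Word k) :
    ((Finset.univ.filter fun x : Word n => L (bitwise (h fun j => x j.1) x) ≠
      idealOutcome r g L h m x ∧ L x = some m).card : ℝ) ≤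
      16 * n * (2 ^ g)⁻¹ * ((2 ^ (k + g))⁻¹ * 2 ^ n) := by
  set bad := Finset.univ.filter fun x : Word n => L (bitwise (h fun j => x j.1) x) ≠
      idealOutcome r g L h m x ∧ L x = some m
  let cell : ({i : Fin n // i ∈ S} → Bool) × Fin n × Bool → Finset (Word n) :=
    fun ⟨α, i, b⟩ => if r + 2 * g < (S ∪ freeCoords (h α)).card then
      (cube S (extendWord α)).filter fun x => (x i = b ∧ h α i (x i) ≠ b) ∧
        (L x = some m ∧ L (bitwise (h α) x) ≠ none) else ∅
  have hcell : ∀ j, ((cell j).card : ℝ) ≤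
      8 * (2 ^ g)⁻¹ * (2 ^ (k + g))⁻¹ * ((2 ^ r)⁻¹ * 2 ^ n) := by
    rintro ⟨α, i, b⟩
    simp only [cell]
    split_ifs with hc
    · have h2 := card_cube_div S (extendWord α)
      rw [div_eq_iff (by positivity), hS] at h2
      rw [← h2]
      exact hL.pair_count S (extendWord α) (h α) i b m hS hc
    · simp only [Finset.card_empty, Nat.cast_zero]; positivity
  have hsub : bad ⊆ Finset.univ.biUnion cell := by
    intro x hx
    obtain ⟨hne, hxm⟩ := (Finset.mem_filter.1 hx).2
    set α : {i : Fin n // i ∈ S} → Bool := fun j => x j.1 with hα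
    have hxα : x ∈ cube S (extendWord α) := by
      rw [← filter_restrict_eq_cube]; simp [hα]
    rw [idealOutcome, ← hα] at hne
    split_ifs at hne with hc hfix
    · exact absurd rfl hne
    · rw [hfix] at hne; exact absurd hxm hne
    · obtain ⟨i, hi⟩ := Function.ne_iff.1 hfix
      refine Finset.mem_biUnion.2 ⟨(α, i, x i), Finset.mem_univ _, ?_⟩
      simp only [cell, not_le.1 hc, if_true]
      exact Finset.mem_filter.2 ⟨hxα, ⟨rfl, hi⟩, hxm, hne⟩
  calc (bad.card : ℝ) ≤ ∑ j, ((cell j).card : ℝ) := by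
        exact_mod_cast (Finset.card_le_card hsub).trans Finset.card_biUnion_le
    _ ≤ ∑ _j : ({i : Fin n // i ∈ S} → Bool) × Fin n × Bool,
        8 * (2 ^ g)⁻¹ * (2 ^ (k + g))⁻¹ * ((2 ^ r)⁻¹ * 2 ^ n) :=
        Finset.sum_le_sum fun j _ => hcell j
    _ = _ := by
        simp only [Finset.sum_const, nsmul_eq_mul, Finset.card_univ, Fintype.card_prod,
          Fintype.card_fun, Fintype.card_fin,
          Fintype.card_bool, Fintype.card_coe, hS, Nat.cast_mul, Nat.cast_pow, Nat.cast_ofNat]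
        field_simp
        ring

theorem nonMalleable (hL : IsPseudorandom r g L) (hn : 1 ≤ n) (hg : 1 ≤ g) :
    NonMalleable (labelEnc L (hL.nonempty hg)) L (FBIT n r n) (64 * n * (2 ^ g)⁻¹) := by
  rintro f ⟨S, Sw, hS, hSw, g', hf⟩
  obtain rfl : Sw = Finset.univ := (Finset.card_eq_iff_eq_univ Sw).1 (by simpa using hSw)
  let h : ({i : Fin n // i ∈ S} → Bool) → Fin n → Bool → Bool :=
    fun α i => g' α ⟨i, Finset.mem_univ i⟩
  have hfh : ∀ x, f x = bitwise (h fun j => x j.1) x := by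
    intro x; ext i; simp [hf x i, bitwise, h]
  let ψ : Word n → NMOut k := fun x =>
    if (S ∪ freeCoords (h fun j => x j.1)).card ≤ r + 2 * g then
      (L (f x)).elim (Sum.inr false) Sum.inl
    else Sum.inr (decide (f x = x))
  have hψ : ∀ m x, patchOut m (ψ x) = idealOutcome r g L h m x := by
    intro m x
    simp only [ψ, idealOutcome, hfh]
    split_ifs with hc hfix
    · cases L (bitwise (h fun j => x j.1) x) <;> rfl
    · simp [hfix, patchOut]
    · simp [hfix, patchOut]
  refine ⟨(PMF.uniformOfFintype (Word n)).map ψ, fun m => ?_⟩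
  have e1 : PatchDist ((PMF.uniformOfFintype (Word n)).map ψ) m =
      (PMF.uniformOfFintype (Word n)).map (idealOutcome r g L h m) := by
    rw [PatchDist, PMF.map_comp]
    congr 1
    ext1 x
    exact hψ m x
  rw [e1, TamperDist]
  have h1 := SD_map_map_le (labelEnc L (hL.nonempty hg) m) (fun c => L (f c))
    (idealOutcome r g L h m)
  have h2 := hL.SD_map_labelEnc_uniform_le hg m (idealOutcome r g L h m)
  have h3 := hL.sum_abs_discrepancy_idealOutcome_le hS h m
  have h4 : ∑ x with L (f x) ≠ idealOutcome r g L h m x,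
      (labelEnc L (hL.nonempty hg) m x).toReal ≤ 32 * n * (2 ^ g)⁻¹ := by
    simp only [labelEnc_apply, ← Finset.sum_filter, Finset.filter_filter, Finset.sum_const,
      nsmul_eq_mul, hfh]
    have h5 := hL.card_ne_idealOutcome_le hS h m
    have h6 := hL.half_le_card hg m
    have h7 : (0 : ℝ) < (2 ^ (k + g))⁻¹ * 2 ^ n := by positivity
    rw [← div_eq_mul_inv, div_le_iff₀ (by linarith)]
    refine h5.trans ?_
    have := mul_le_mul_of_nonneg_left h6 (show (0 : ℝ) ≤ 32 * n * (2 ^ g)⁻¹ by positivity)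
    linarith
  have h8 := SD_triangle ((labelEnc L (hL.nonempty hg) m).map fun c => L (f c))
    ((labelEnc L (hL.nonempty hg) m).map (idealOutcome r g L h m))
    ((PMF.uniformOfFintype (Word n)).map (idealOutcome r g L h m))
  have h9 : (1 : ℝ) * (2 ^ g)⁻¹ ≤ n * (2 ^ g)⁻¹ := by
    gcongr; exact_mod_cast hn
  have h10 : (0 : ℝ) ≤ n * (2 ^ g)⁻¹ := by positivity
  refine h8.trans ((add_le_add (h1.trans h4) (h2.trans (div_le_div_of_nonneg_right
    (add_le_add_right h3 _) zero_le_two))).trans ?_)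
  linarith

end IsPseudorandom

end Code

/-- Linear-times-exponential estimate used to absorb polynomial losses. -/
theorem exists_forall_mul_le_two_pow_floor {ξ : ℝ} (hξ : 0 < ξ) :
    ∃ n₀ : ℕ, ∀ n : ℕ, n₀ ≤ n → 2 ≤ ⌊ξ * n⌋₊ ∧
      64 * (n : ℝ) * (2 ^ ⌊ξ * n⌋₊)⁻¹ ≤ 2 ^ (-(ξ / 2 * n)) := by
  have h1 : Filter.Tendsto (fun n : ℕ => (n : ℝ) * ((2 : ℝ) ^ (-(ξ / 2))) ^ n) Filter.atTop
      (nhds 0) := by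
    refine tendsto_self_mul_const_pow_of_lt_one (by positivity) ?_
    exact Real.rpow_lt_one_of_one_lt_of_neg (by norm_num) (by linarith)
  have h2 := h1.eventually (gt_mem_nhds (show (0 : ℝ) < 1 / 128 by norm_num))
  obtain ⟨a, ha⟩ := Filter.eventually_atTop.1 h2
  refine ⟨max a ⌈2 / ξ⌉₊, fun n hn => ?_⟩
  have hna := ha n (le_of_max_le_left hn)
  have hnb : 2 / ξ ≤ n := (Nat.le_ceil _).trans (by exact_mod_cast le_of_max_le_right hn)
  refine ⟨Nat.le_floor (by rw [div_le_iff₀ hξ] at hnb; push_cast; linarith), ?_⟩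
  have h3 : (2 : ℝ) ^ (ξ * n - 1) ≤ 2 ^ ⌊ξ * n⌋₊ := by
    rw [← Real.rpow_natCast]
    exact Real.rpow_le_rpow_of_exponent_le (by norm_num) (by linarith [Nat.lt_floor_add_one (ξ * n)])
  have h4 : ((2 : ℝ) ^ ⌊ξ * n⌋₊)⁻¹ ≤ 2 * (2 ^ (-(ξ / 2))) ^ n * 2 ^ (-(ξ / 2 * n)) := by
    refine (inv_anti₀ (by positivity) h3).trans (le_of_eq ?_)
    rw [← Real.rpow_neg (by norm_num), ← Real.rpow_mul_natCast (by norm_num), mul_assoc,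
      ← Real.rpow_add (by norm_num)]
    nth_rw 2 [← Real.rpow_one 2]
    rw [← Real.rpow_add (by norm_num)]
    ring_nf
  have h5 := mul_le_mul_of_nonneg_left h4 (show (0 : ℝ) ≤ 64 * n by positivity)
  refine h5.trans ?_
  have h6 : (0 : ℝ) < 2 ^ (-(ξ / 2 * n)) := by positivity
  nlinarith
/-- Achievability of rate `1 − ρ_r` for `(ρ_r,1)`-active adversary wiretap II
codes: for all large enough `n` there is a `(k,n)`-coding scheme with
`k ≥ n(1 − ρ_r − ξ)` satisfying both secrecy against `⌊nρ_r⌋`-coordinate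
leakage and non-malleability with respect to `F_BIT^{[n],⌊nρ_r⌋,n}`, with both
parameters at most `2^{−cn}`. -/
theorem active_wiretapII_capacity_lower_bound
    (ρr ξ : ℝ) (hρr0 : 0 < ρr) (hρr1 : ρr < 1) (hξ0 : 0 < ξ) (hξ1 : ξ < 1 - ρr) :
    ∃ c : ℝ, 0 < c ∧ ∃ n0 : ℕ, ∀ n : ℕ, n0 ≤ n →
      ∃ (k : ℕ) (Enc : Word k → PMF (Word n)) (Dec : Word n → Option (Word k)),
        Correct Enc Dec ∧
        (n : ℝ) * (1 - ρr - ξ) ≤ (k : ℝ) ∧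
        (∀ S : Finset (Fin n), S.card ≤ ⌊(n : ℝ) * ρr⌋₊ → ∀ m0 m1 : Word k,
          SD (restrictPMF S (Enc m0)) (restrictPMF S (Enc m1))
            ≤ (2 : ℝ) ^ (-(c * (n : ℝ)))) ∧
        NonMalleable Enc Dec (FBIT n ⌊(n : ℝ) * ρr⌋₊ n)
          ((2 : ℝ) ^ (-(c * (n : ℝ)))) := by
  obtain ⟨n₀, hn₀⟩ := exists_forall_mul_le_two_pow_floor (show 0 < ξ / 16 by positivity)
  refine ⟨ξ / 16 / 2, by positivity, max (max n₀ 1) ⌈2 / ξ⌉₊, fun n hn => ?_⟩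
  have hn1 : 1 ≤ n := (le_max_right _ _).trans ((le_max_left _ _).trans hn)
  have hnξ : 2 ≤ n * ξ := by
    have : 2 / ξ ≤ n := (Nat.le_ceil _).trans (by exact_mod_cast (le_max_right _ _).trans hn)
    rwa [div_le_iff₀ hξ0] at this
  obtain ⟨hg, hε⟩ := hn₀ n ((le_max_left _ _).trans ((le_max_left _ _).trans hn))
  set g := ⌊ξ / 16 * n⌋₊
  set r := ⌊(n : ℝ) * ρr⌋₊
  set k := ⌈(n : ℝ) * (1 - ρr - ξ)⌉₊
  have hgle : (g : ℝ) ≤ ξ / 16 * n := Nat.floor_le (by positivity)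
  have hrle : (r : ℝ) ≤ n * ρr := Nat.floor_le (by positivity)
  have hkle : (k : ℝ) < n * (1 - ρr - ξ) + 1 :=
    Nat.ceil_lt_add_one (mul_nonneg (Nat.cast_nonneg _) (by linarith))
  have hrk : r + k + 8 * g ≤ n := by
    have : (r : ℝ) + k + 8 * g ≤ n := by nlinarith
    exact_mod_cast this
  have hng : 8 * n ≤ 2 ^ g := by
    have h1 : (2 : ℝ) ^ (-(ξ / 16 / 2 * n)) ≤ 1 :=
      Real.rpow_le_one_of_one_le_of_nonpos (by norm_num) (by
        have : 0 ≤ ξ / 16 / 2 * n := by positivity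
        linarith)
    have h2 := hε.trans h1
    rw [← div_eq_mul_inv, div_le_one (by positivity)] at h2
    have : (8 : ℝ) * n ≤ 2 ^ g := by linarith [Nat.cast_nonneg (α := ℝ) n]
    exact_mod_cast this
  obtain ⟨L, hL⟩ := exists_isPseudorandom (r := r) (k := k) hn1 hg hrk hng
  have hg1 : 1 ≤ g := by omega
  refine ⟨k, labelEnc L (hL.nonempty hg1), L, labelEnc_correct _, Nat.le_ceil _,
    fun S hS m₀ m₁ => (hL.secrecy hg1 hS m₀ m₁).trans (le_trans ?_ hε), fun f hf => ?_⟩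
  · have : (1 : ℝ) ≤ n := by exact_mod_cast hn1
    gcongr
    linarith
  · obtain ⟨D, hD⟩ := hL.nonMalleable hn1 hg1 f hf
    exact ⟨D, fun m => (hD m).trans hε⟩
end
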